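/- Let 1 < p < ∞ and let w be a positive measurable function on ℝⁿ×ℝᵐ such that log w ∈ bmo_F(ℝⁿ×ℝᵐ). Then there exists η₀ > 0 (depending on n, m, p and ‖log w‖_{bmo_F}) such that for all 0 < η ≤ η₀, the function w^η belongs to A_{F,p}, i.e. [w^η]_{A_{F,p}} < ∞. -/

import Mathlib

open MeasureTheory Filter Topology Set

noncomputable section

namespace FlagPaper

/-- Euclidean norm squared on `Fin d → ℝ`. -/
def eSq {d : ℕ} (x : Fin d → ℝ) : ℝ := ∑ i, x i ^ 2

/-- Euclidean norm on `Fin d → ℝ`. -/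
def eN {d : ℕ} (x : Fin d → ℝ) : ℝ := Real.sqrt (eSq x)

/-- The point space ℝⁿ × ℝᵐ. -/
abbrev Spc (n m : ℕ) := (Fin n → ℝ) × (Fin m → ℝ)

/-- Euclidean norm of a point of ℝⁿ × ℝᵐ viewed in ℝ^{n+m}. -/
def eNP {n m : ℕ} (u : Spc n m) : ℝ := Real.sqrt (eSq u.1 + eSq u.2)

/-- Normalizing constant for the Poisson kernel on ℝ^d, chosen so the kernel has integral 1. -/
def pC (d : ℕ) : ℝ := (∫ x : Fin d → ℝ, (1 + eSq x) ^ (-((d : ℝ) + 1) / 2))⁻¹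

/-- Poisson kernel on ℝ^d. -/
def pK (d : ℕ) (x : Fin d → ℝ) : ℝ := pC d * (1 + eSq x) ^ (-((d : ℝ) + 1) / 2)

/-- Dilated Poisson kernel `P_t` on ℝ^d. -/
def pKt (d : ℕ) (t : ℝ) (x : Fin d → ℝ) : ℝ := t ^ (-(d : ℝ)) * pK d (fun i => x i / t)

/-- Normalizing constant for the Poisson kernel of ℝ^{n+m}, realized on ℝⁿ × ℝᵐ. -/
def pC1 (n m : ℕ) : ℝ := (∫ u : Spc n m, (1 + eSq u.1 + eSq u.2) ^ (-((n : ℝ) + m + 1) / 2))⁻¹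

/-- Poisson kernel `P^{(1)}` of ℝ^{n+m}, realized on ℝⁿ × ℝᵐ. -/
def pK1 (n m : ℕ) (u : Spc n m) : ℝ := pC1 n m * (1 + eSq u.1 + eSq u.2) ^ (-((n : ℝ) + m + 1) / 2)

/-- Dilated kernel `P^{(1)}_{t}`. -/
def pK1t (n m : ℕ) (t : ℝ) (u : Spc n m) : ℝ :=
  t ^ (-((n : ℝ) + m)) * pK1 n m (fun i => u.1 i / t, fun j => u.2 j / t)

/-- The flag Poisson kernel `P_{t₁,t₂} = P^{(1)}_{t₁} *_{ℝᵐ} P^{(2)}_{t₂}`. -/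
def flagP (n m : ℕ) (t₁ t₂ : ℝ) (u : Spc n m) : ℝ :=
  ∫ z : Fin m → ℝ, pK1t n m t₁ (u.1, u.2 - z) * pKt m t₂ z

/-- The flag upper half-space parameter domain: points `(x₁, x₂, t₁, t₂)`. -/
abbrev Dom (n m : ℕ) := (Fin n → ℝ) × (Fin m → ℝ) × ℝ × ℝ

def t1 {n m : ℕ} (q : Dom n m) : ℝ := q.2.2.1
def t2 {n m : ℕ} (q : Dom n m) : ℝ := q.2.2.2

/-- The region `ℝ^{n+1}_+ × ℝ^{m+1}_+`, i.e. `t₁ > 0`, `t₂ > 0`. -/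
def domPos (n m : ℕ) : Set (Dom n m) := {q | 0 < t1 q ∧ 0 < t2 q}

/-- Flag Poisson extension of a function on ℝⁿ × ℝᵐ. -/
def flagExt {n m : ℕ} (f : Spc n m → ℝ) (q : Dom n m) : ℝ :=
  ∫ y : Spc n m, flagP n m (t1 q) (t2 q) (q.1 - y.1, q.2.1 - y.2) * f y

/-- Directional (partial) derivative in direction `v`. -/
def pd {n m : ℕ} (v : Dom n m) (U : Dom n m → ℝ) (q : Dom n m) : ℝ := fderiv ℝ U q v

def e1 {n m : ℕ} (i : Fin n) : Dom n m := (Pi.single i 1, 0, 0, 0)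
def e2 {n m : ℕ} (j : Fin m) : Dom n m := (0, Pi.single j 1, 0, 0)
def et1 (n m : ℕ) : Dom n m := (0, 0, 1, 0)
def et2 (n m : ℕ) : Dom n m := (0, 0, 0, 1)

/-- Directions of the gradient `∇^{(1)} = (∂_{t₁}, ∇_{x₁}, ∇_{x₂})` on ℝ^{n+m+1}. -/
def dirs1 (n m : ℕ) : List (Dom n m) :=
  et1 n m :: (List.ofFn (fun i : Fin n => e1 (m := m) i) ++ List.ofFn (fun j : Fin m => e2 (n := n) j))

/-- Directions of the gradient `∇^{(2)} = (∂_{t₂}, ∇_{x₂})` on ℝ^{m+1}. -/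
def dirs2 (n m : ℕ) : List (Dom n m) :=
  et2 n m :: List.ofFn (fun j : Fin m => e2 (n := n) j)

/-- Directions of the spatial gradient `∇_{x₁,x₂}`. -/
def dirsX (n m : ℕ) : List (Dom n m) :=
  List.ofFn (fun i : Fin n => e1 (m := m) i) ++ List.ofFn (fun j : Fin m => e2 (n := n) j)

/-- Directions of the gradient `∇_{x₂}`. -/
def dirsY (n m : ℕ) : List (Dom n m) :=
  List.ofFn (fun j : Fin m => e2 (n := n) j)

/-- Squared magnitude of the array of mixed second derivatives w.r.t. two families of
directions. -/
def g2 {n m : ℕ} (L1 L2 : List (Dom n m)) (U : Dom n m → ℝ) (q : Dom n m) : ℝ :=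
  (L1.map (fun a => (L2.map (fun b => (pd a (pd b U) q) ^ 2)).sum)).sum

/-- Squared magnitude of the array of mixed third derivatives. -/
def g3 {n m : ℕ} (L1 L2 L3 : List (Dom n m)) (U : Dom n m → ℝ) (q : Dom n m) : ℝ :=
  (L1.map (fun a => (L2.map (fun b => (L3.map (fun c =>
    (pd a (pd b (pd c U)) q) ^ 2)).sum)).sum)).sum

/-- Squared magnitude of the array of mixed fourth derivatives. -/
def g4 {n m : ℕ} (L1 L2 L3 L4 : List (Dom n m)) (U : Dom n m → ℝ) (q : Dom n m) : ℝ :=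
  (L1.map (fun a => (L2.map (fun b => (L3.map (fun c => (L4.map (fun d =>
    (pd a (pd b (pd c (pd d U))) q) ^ 2)).sum)).sum)).sum)).sum

/-- An axes-parallel cube in ℝ^d with corner `a` and side length `ℓ`. -/
def cube {d : ℕ} (a : Fin d → ℝ) (ℓ : ℝ) : Set (Fin d → ℝ) :=
  {x | ∀ i, a i ≤ x i ∧ x i ≤ a i + ℓ}

/-- A flag rectangle `I × J`. -/
def flagRect {n m : ℕ} (a : Fin n → ℝ) (ℓI : ℝ) (c : Fin m → ℝ) (ℓJ : ℝ) : Set (Spc n m) :=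
  cube a ℓI ×ˢ cube c ℓJ

/-- Average of `f` over a set. -/
def avgOn {α : Type*} [MeasureSpace α] (S : Set α) (f : α → ℝ) : ℝ :=
  (volume S).toReal⁻¹ * ∫ x in S, f x

/-- Mean oscillation of `f` over a set. -/
def oscOn {α : Type*} [MeasureSpace α] (S : Set α) (f : α → ℝ) : ℝ :=
  avgOn S (fun x => |f x - avgOn S f|)

/-- Set of mean oscillations over flag rectangles (the little flag bmo data). -/
def bmoFSet (n m : ℕ) (b : Spc n m → ℝ) : Set ℝ :=
  {v | ∃ a ℓI c ℓJ, 0 < ℓI ∧ ℓI ≤ ℓJ ∧ v = oscOn (flagRect a ℓI c ℓJ) b}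

/-- The little flag bmo norm `‖b‖_{bmo_F}`. -/
def bmoFNorm (n m : ℕ) (b : Spc n m → ℝ) : ℝ := sSup (bmoFSet n m b)

/-- Set of mean oscillations over cubes in ℝ^d (John–Nirenberg BMO data). -/
def bmoSet (d : ℕ) (g : (Fin d → ℝ) → ℝ) : Set ℝ :=
  {v | ∃ a ℓ, 0 < ℓ ∧ v = oscOn (cube a ℓ) g}

/-- The John–Nirenberg BMO(ℝ^d) norm. -/
def bmoNorm (d : ℕ) (g : (Fin d → ℝ) → ℝ) : ℝ := sSup (bmoSet d g)

/-- BMO(ℝ^{n+m}) data for a function on the product model ℝⁿ × ℝᵐ: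
cubes of ℝ^{n+m} are exactly products `I × J` with `ℓ(I) = ℓ(J)`. -/
def bmoProdSet (n m : ℕ) (b : Spc n m → ℝ) : Set ℝ :=
  {v | ∃ a c ℓ, 0 < ℓ ∧ v = oscOn (flagRect a ℓ c ℓ) b}

/-- The BMO(ℝ^{n+m}) norm on the product model. -/
def bmoProdNorm (n m : ℕ) (b : Spc n m → ℝ) : ℝ := sSup (bmoProdSet n m b)

/-- The set of `A_{F,p}` products of averages over flag rectangles. -/
def apSet (n m : ℕ) (p : ℝ) (w : Spc n m → ℝ) : Set ℝ :=
  {v | ∃ a ℓI c ℓJ, 0 < ℓI ∧ ℓI ≤ ℓJ ∧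
    v = avgOn (flagRect a ℓI c ℓJ) w *
      (avgOn (flagRect a ℓI c ℓJ) (fun x => w x ^ (1 - p / (p - 1)))) ^ (p - 1)}

/-- The flag Muckenhoupt characteristic `[w]_{A_{F,p}}`. -/
def apChar (n m : ℕ) (p : ℝ) (w : Spc n m → ℝ) : ℝ := sSup (apSet n m p w)

/-- The Carleson box `T(R)` over the flag rectangle determined by `a, ℓI, c, ℓJ`. -/
def TBox {n m : ℕ} (a : Fin n → ℝ) (ℓI : ℝ) (c : Fin m → ℝ) (ℓJ : ℝ) : Set (Dom n m) :=
  {q | q.1 ∈ cube a ℓI ∧ (ℓI / 2 < t1 q ∧ t1 q ≤ ℓI) ∧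
       q.2.1 ∈ cube c ℓJ ∧ (ℓJ / 2 < t2 q ∧ t2 q ≤ ℓJ)}

/-- `T(Ω) = ⋃_{R ⊂ Ω} T(R)`, the union over flag rectangles contained in `Ω`. -/
def TOmega {n m : ℕ} (Ω : Set (Spc n m)) : Set (Dom n m) :=
  ⋃ (a : Fin n → ℝ) (ℓI : ℝ) (c : Fin m → ℝ) (ℓJ : ℝ)
    (_ : 0 < ℓI ∧ ℓI ≤ ℓJ ∧ flagRect a ℓI c ℓJ ⊆ Ω), TBox a ℓI c ℓJ

/-- Set of flag Carleson quantities defining the flag BMO norm of `b`. -/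
def flagBMOSet (n m : ℕ) (b : Spc n m → ℝ) : Set ℝ :=
  {v | ∃ Ω : Set (Spc n m), IsOpen Ω ∧ 0 < volume Ω ∧ volume Ω ≠ ⊤ ∧
    v = Real.sqrt ((volume Ω).toReal⁻¹ *
      ∫ q in TOmega Ω, (t1 q) ^ 2 * (t2 q) ^ 2 *
        g2 (dirs1 n m) (dirs2 n m) (flagExt b) q / (t1 q * t2 q))}

/-- The flag BMO norm `‖b‖_{BMO_F}`. -/
def flagBMONorm (n m : ℕ) (b : Spc n m → ℝ) : ℝ := sSup (flagBMOSet n m b)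

/-- Dilated indicator `χ^{(1)}_{t}` of the unit ball of ℝ^{n+m}. -/
def chi1t (n m : ℕ) (t : ℝ) (u : Spc n m) : ℝ :=
  t ^ (-((n : ℝ) + m)) *
    (if eSq (fun i => u.1 i / t) + eSq (fun j => u.2 j / t) ≤ 1 then (1 : ℝ) else 0)

/-- Dilated indicator `χ^{(2)}_{t}` of the unit ball of ℝᵐ. -/
def chi2t (m : ℕ) (t : ℝ) (z : Fin m → ℝ) : ℝ :=
  t ^ (-(m : ℝ)) * (if eSq (fun j => z j / t) ≤ 1 then (1 : ℝ) else 0)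

/-- `χ_{t₁,t₂} = χ^{(1)}_{t₁} *_{ℝᵐ} χ^{(2)}_{t₂}`. -/
def chiF (n m : ℕ) (t₁ t₂ : ℝ) (u : Spc n m) : ℝ :=
  ∫ z : Fin m → ℝ, chi1t n m t₁ (u.1, u.2 - z) * chi2t m t₂ z

/-- The general flag Lusin area integral `S_{F,L}(G)`. -/
def SFL (n m : ℕ) (G : Dom n m → ℝ) (x : Spc n m) : ℝ :=
  Real.sqrt (∫ q in domPos n m,
    chiF n m (t1 q) (t2 q) (x.1 - q.1, x.2 - q.2.1) * (G q) ^ 2 /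
      ((t1 q) ^ (n + m + 1) * (t2 q) ^ (m + 1)))

/-- The flag Lusin area integral `S_F(u)` of the flag Poisson extension of `f`. -/
def SFlag (n m : ℕ) (f : Spc n m → ℝ) (x : Spc n m) : ℝ :=
  Real.sqrt (∫ q in domPos n m,
    chiF n m (t1 q) (t2 q) (x.1 - q.1, x.2 - q.2.1) *
      ((t1 q) ^ 2 * (t2 q) ^ 2 * g2 (dirs1 n m) (dirs2 n m) (flagExt f) q) /
      ((t1 q) ^ (n + m + 1) * (t2 q) ^ (m + 1)))

/-- The constant `c_d` of the Riesz transforms on ℝ^d. -/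
def rieszC (d : ℕ) : ℝ := Real.Gamma (((d : ℝ) + 1) / 2) / Real.pi ^ (((d : ℝ) + 1) / 2)

/-- The `j`-th Riesz transform `R^{(1)}_j` on ℝ^{n+m} (realized on ℝⁿ × ℝᵐ),
defined as a principal value. -/
def R1 {n m : ℕ} (j : Fin (n + m)) (g : Spc n m → ℝ) (x : Spc n m) : ℝ :=
  limUnder (𝓝[>] (0 : ℝ)) (fun ε =>
    rieszC (n + m) * ∫ y in {y : Spc n m | ε < eNP (x - y)},
      (Fin.append x.1 x.2 j - Fin.append y.1 y.2 j) / eNP (x - y) ^ (n + m + 1) * g y)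

/-- The `k`-th Riesz transform `R^{(2)}_k` on ℝᵐ acting in the second variable,
defined as a principal value. -/
def R2 {n m : ℕ} (k : Fin m) (f : Spc n m → ℝ) (x : Spc n m) : ℝ :=
  limUnder (𝓝[>] (0 : ℝ)) (fun ε =>
    rieszC m * ∫ z in {z : Fin m → ℝ | ε < eN (x.2 - z)},
      (x.2 k - z k) / eN (x.2 - z) ^ (m + 1) * f (x.1, z))

/-- The iterated commutator `[[b, R^{(1)}_j], R^{(2)}_k]₂ f`. -/
def iterCommR {n m : ℕ} (b : Spc n m → ℝ) (j : Fin (n + m)) (k : Fin m)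
    (f : Spc n m → ℝ) : Spc n m → ℝ := fun x =>
  b x * R1 j (R2 k f) x - R1 j (fun u => b u * R2 k f u) x
    - R2 k (fun u => b u * R1 j f u) x + R2 k (R1 j (fun u => b u * f u)) x

/-- The iterated commutator `[[b, R^{(2)}_k]₂, R^{(1)}_j] f`. -/
def iterCommR' {n m : ℕ} (b : Spc n m → ℝ) (j : Fin (n + m)) (k : Fin m)
    (f : Spc n m → ℝ) : Spc n m → ℝ := fun x =>
  b x * R2 k (R1 j f) x - R2 k (fun u => b u * R1 j f u) x
    - R1 j (fun u => b u * R2 k f u) x + R1 j (R2 k (fun u => b u * f u)) x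

/-- The big commutator `[b, R_{j,k}] f` where `R_{j,k} = R^{(1)}_j ∗ R^{(2)}_k ∗₂ ·`. -/
def bigCommR {n m : ℕ} (b : Spc n m → ℝ) (j : Fin (n + m)) (k : Fin m)
    (f : Spc n m → ℝ) : Spc n m → ℝ := fun x =>
  b x * R1 j (R2 k f) x - R1 j (R2 k (fun u => b u * f u)) x

/-- Explicit `L^p` norm. -/
def lpNorm {α : Type*} [MeasureSpace α] (p : ℝ) (f : α → ℝ) : ℝ :=
  (∫ x, |f x| ^ p) ^ (1 / p)

/-- Dot product on ℝⁿ × ℝᵐ viewed as ℝ^{n+m}. -/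
def dotS {n m : ℕ} (u v : Spc n m) : ℝ := (∑ i, u.1 i * v.1 i) + ∑ j, u.2 j * v.2 j

/-- Fourier transform on ℝⁿ × ℝᵐ ≅ ℝ^{n+m}. -/
def fT {n m : ℕ} (g : Spc n m → ℝ) (ξ : Spc n m) : ℂ :=
  ∫ y : Spc n m, Complex.exp (-(((2 * Real.pi * dotS y ξ : ℝ) : ℂ) * Complex.I)) * (g y : ℂ)

/-- The Fourier multiplier `(−Δ_{x₁,x₂})^{1/2}` with symbol `2π|(ξ₁,ξ₂)|`. -/
def sqlapFull {n m : ℕ} (g : Spc n m → ℝ) (x : Spc n m) : ℝ :=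
  (∫ ξ : Spc n m, Complex.exp (((2 * Real.pi * dotS x ξ : ℝ) : ℂ) * Complex.I) *
    ((2 * Real.pi * eNP ξ : ℝ) : ℂ) * fT g ξ).re

/-- Fourier transform on ℝᵐ. -/
def fT2 {m : ℕ} (g : (Fin m → ℝ) → ℝ) (ξ : Fin m → ℝ) : ℂ :=
  ∫ z : Fin m → ℝ,
    Complex.exp (-(((2 * Real.pi * ∑ j, z j * ξ j : ℝ) : ℂ) * Complex.I)) * (g z : ℂ)

/-- The Fourier multiplier `(−Δ_{x₂})^{1/2}` with symbol `2π|ξ₂|`, acting in the second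
variable. -/
def sqlap2 {n m : ℕ} (g : Spc n m → ℝ) (x : Spc n m) : ℝ :=
  (∫ ξ : Fin m → ℝ, Complex.exp (((2 * Real.pi * ∑ j, x.2 j * ξ j : ℝ) : ℂ) * Complex.I) *
    ((2 * Real.pi * eN ξ : ℝ) : ℂ) * fT2 (fun z => g (x.1, z)) ξ).re

/-- Coordinate direction in ℝⁿ × ℝᵐ ≅ ℝ^{n+m}. -/
def edir (n m : ℕ) (j : Fin (n + m)) : Spc n m :=
  Fin.addCases (motive := fun _ => Spc n m)
    (fun i => (Pi.single i 1, 0)) (fun i => (0, Pi.single i 1)) j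

/-- Distributional divergence-free condition for a vector field on ℝⁿ × ℝᵐ ≅ ℝ^{n+m}. -/
def divFree (n m : ℕ) (E : Spc n m → Fin (n + m) → ℝ) : Prop :=
  ∀ φ : Spc n m → ℝ, ContDiff ℝ (⊤ : ℕ∞) φ → HasCompactSupport φ →
    ∑ j, ∫ u, E u j * fderiv ℝ φ u (edir n m j) = 0

/-- Distributional curl-free condition for a vector field on ℝⁿ × ℝᵐ ≅ ℝ^{n+m}. -/
def curlFree (n m : ℕ) (B : Spc n m → Fin (n + m) → ℝ) : Prop :=
  ∀ φ : Spc n m → ℝ, ContDiff ℝ (⊤ : ℕ∞) φ → HasCompactSupport φ →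
    ∀ i j : Fin (n + m),
      ∫ u, B u j * fderiv ℝ φ u (edir n m i) = ∫ u, B u i * fderiv ℝ φ u (edir n m j)

/-- Distributional divergence-free condition for a vector field on ℝᵐ. -/
def divFreeM (m : ℕ) (E : (Fin m → ℝ) → Fin m → ℝ) : Prop :=
  ∀ φ : (Fin m → ℝ) → ℝ, ContDiff ℝ (⊤ : ℕ∞) φ → HasCompactSupport φ →
    ∑ k, ∫ z, E z k * fderiv ℝ φ z (Pi.single k 1) = 0

/-- Distributional curl-free condition for a vector field on ℝᵐ. -/
def curlFreeM (m : ℕ) (B : (Fin m → ℝ) → Fin m → ℝ) : Prop :=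
  ∀ φ : (Fin m → ℝ) → ℝ, ContDiff ℝ (⊤ : ℕ∞) φ → HasCompactSupport φ →
    ∀ k k' : Fin m,
      ∫ z, B z k' * fderiv ℝ φ z (Pi.single k 1) = ∫ z, B z k * fderiv ℝ φ z (Pi.single k' 1)

/-- The matrix entries `E_{j,k} = E^{(1)}_j ∗₂ E^{(2)}_k`. -/
def pairField (n m : ℕ) (E1 : Spc n m → Fin (n + m) → ℝ) (E2 : (Fin m → ℝ) → Fin m → ℝ)
    (u : Spc n m) (j : Fin (n + m)) (k : Fin m) : ℝ :=
  ∫ z : Fin m → ℝ, E1 (u.1, u.2 - z) j * E2 z k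

/-- The dot product `E · B` of two matrix-valued flag fields. -/
def dotField (n m : ℕ) (E1 : Spc n m → Fin (n + m) → ℝ) (E2 : (Fin m → ℝ) → Fin m → ℝ)
    (B1 : Spc n m → Fin (n + m) → ℝ) (B2 : (Fin m → ℝ) → Fin m → ℝ) (u : Spc n m) : ℝ :=
  ∑ j : Fin (n + m), ∑ k : Fin m, pairField n m E1 E2 u j k * pairField n m B1 B2 u j k

/-- One-parameter directional derivative on (ℝⁿ × ℝᵐ) × ℝ. -/
def pd1 {n m : ℕ} (v : Spc n m × ℝ) (U : Spc n m × ℝ → ℝ) (q : Spc n m × ℝ) : ℝ :=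
  fderiv ℝ U q v

/-- Squared magnitude of the full gradient `∇_{x,t}` on ℝ^{n+m+1}. -/
def grad1Sq {n m : ℕ} (U : Spc n m × ℝ → ℝ) (q : Spc n m × ℝ) : ℝ :=
  (pd1 ((0, 0), 1) U q) ^ 2 + (∑ i : Fin n, (pd1 ((Pi.single i 1, 0), 0) U q) ^ 2)
    + ∑ j : Fin m, (pd1 ((0, Pi.single j 1), 0) U q) ^ 2

/-- One-parameter Poisson extension of a function on ℝⁿ × ℝᵐ ≅ ℝ^{n+m}. -/
def pExt1 {n m : ℕ} (f : Spc n m → ℝ) (q : Spc n m × ℝ) : ℝ :=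
  ∫ y : Spc n m, pK1t n m q.2 (q.1.1 - y.1, q.1.2 - y.2) * f y

/-- The classical one-parameter Lusin area integral on ℝ^{n+m} of (the Poisson extension of)
`f`, characterizing the Hardy space `H¹(ℝ^{n+m})`. -/
def SOne (n m : ℕ) (f : Spc n m → ℝ) (x : Spc n m) : ℝ :=
  Real.sqrt (∫ q in {q : Spc n m × ℝ | 0 < q.2 ∧ eNP (x - q.1) < q.2},
    q.2 ^ 2 * grad1Sq (pExt1 f) q / q.2 ^ (n + m + 1))

/-- Commutator of a function with an operator: `[b,T] f = b ⬝ Tf − T(bf)`. -/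
def commOp {α : Type*} (b : α → ℝ) (T : (α → ℝ) → (α → ℝ)) : (α → ℝ) → (α → ℝ) :=
  fun f => b * T f - T (b * f)

/-- Iterated commutator `C^k_{b⃗}(T) = [b_k, [b_{k−1}, ⋯ [b₁, T] ⋯]]`. -/
def iterCommOp {α : Type*} : (k : ℕ) → (Fin k → α → ℝ) → ((α → ℝ) → (α → ℝ)) →
    ((α → ℝ) → (α → ℝ))
  | 0, _, T => T
  | (k + 1), b, T => commOp (b (Fin.last k)) (iterCommOp k (fun j => b j.castSucc) T)

/-- Weighted measure `w dx`. -/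
def wMeasure {α : Type*} [MeasureSpace α] (w : α → ℝ) : Measure α :=
  volume.withDensity (fun x => ENNReal.ofReal (w x))

end FlagPaper

open FlagPaper MeasureTheory

section NestedPartition

open scoped ENNReal

/-- The mean of `b` over `A` is close to `s` when `b` is close to `s` in `L¹(A)`. -/
theorem abs_average_sub_mul_le_setIntegral {X : Type*} [MeasurableSpace X] {μ : Measure X}
    {A : Set X} {b : X → ℝ} (hA : 0 < μ.real A) (hb : IntegrableOn b A μ) (s : ℝ) :
    |(⨍ x in A, b x ∂μ) - s| * μ.real A ≤ ∫ x in A, |b x - s| ∂μ := by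
  have hfin : μ A ≠ ∞ := fun h => by simp [Measure.real, h] at hA
  have hs : IntegrableOn (fun _ : X => s) A μ := integrableOn_const hfin
  have key : ((⨍ x in A, b x ∂μ) - s) * μ.real A = ∫ x in A, (b x - s) ∂μ := by
    rw [integral_sub hb hs, setAverage_eq, setIntegral_const]
    simp only [smul_eq_mul]
    field_simp
  calc |(⨍ x in A, b x ∂μ) - s| * μ.real A
      = |((⨍ x in A, b x ∂μ) - s) * μ.real A| := by rw [abs_mul, abs_of_pos hA]
    _ = |∫ x in A, (b x - s) ∂μ| := by rw [key]
    _ ≤ ∫ x in A, |b x - s| ∂μ := abs_integral_le_integral_abs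

/-- A family of cells of positive finite measure, each of which is partitioned by its finitely
many children, with comparable measures. -/
structure NestedPartition {X : Type*} [MeasurableSpace X] (μ : Measure X) (ι κ : Type*)
    [Fintype κ] where
  /-- The set of points of a cell. -/
  cell : ι → Set X
  /-- The children of a cell. -/
  child : ι → κ → ι
  /-- The bound for the ratio of the measures of a cell and of its children. -/
  ratio : ℝ
  ratio_nonneg : 0 ≤ ratio
  measurableSet_cell : ∀ Q, MeasurableSet (cell Q)
  measure_cell_pos : ∀ Q, 0 < μ.real (cell Q)
  iUnion_child : ∀ Q, ⋃ k, cell (child Q k) = cell Q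
  disjoint_child : ∀ Q, Pairwise (Function.onFun Disjoint fun k => cell (child Q k))
  measure_le : ∀ Q k, μ.real (cell Q) ≤ ratio * μ.real (cell (child Q k))

namespace NestedPartition

variable {X : Type*} [MeasurableSpace X] {μ : Measure X} {ι κ : Type*} [Fintype κ]

open Classical in
/-- The `N`-th generation descendant of `Q` containing `x`. -/
def descendant (T : NestedPartition μ ι κ) : ℕ → ι → X → ι
  | 0, Q, _ => Q
  | N + 1, Q, x =>
    if h : ∃ k, x ∈ T.cell (T.child Q k) then T.descendant N (T.child Q h.choose) x else Q

/-- The conditional expectation of `b` on the `N`-th generation of descendants of `Q`. -/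
def approx (T : NestedPartition μ ι κ) (b : X → ℝ) (N : ℕ) (Q : ι) (x : X) : ℝ :=
  ⨍ y in T.cell (T.descendant N Q x), b y ∂μ

theorem descendant_succ (T : NestedPartition μ ι κ) (N : ℕ) {Q : ι} {k : κ} {x : X}
    (hx : x ∈ T.cell (T.child Q k)) :
    T.descendant (N + 1) Q x = T.descendant N (T.child Q k) x := by
  have h : ∃ k, x ∈ T.cell (T.child Q k) := ⟨k, hx⟩
  have hk : h.choose = k := by
    by_contra hne
    exact Set.disjoint_left.1 (T.disjoint_child Q hne) h.choose_spec hx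
  rw [descendant, dif_pos h, hk]

theorem exists_mem_child (T : NestedPartition μ ι κ) {Q : ι} {x : X} (hx : x ∈ T.cell Q) :
    ∃ k, x ∈ T.cell (T.child Q k) := by
  rwa [← T.iUnion_child, mem_iUnion] at hx

theorem mem_cell_descendant (T : NestedPartition μ ι κ) (N : ℕ) {Q : ι} {x : X}
    (hx : x ∈ T.cell Q) : x ∈ T.cell (T.descendant N Q x) := by
  induction N generalizing Q with
  | zero => exact hx
  | succ N ih =>
    obtain ⟨k, hk⟩ := T.exists_mem_child hx
    rw [T.descendant_succ N hk]
    exact ih hk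

theorem aemeasurable_approx (T : NestedPartition μ ι κ) (b : X → ℝ) (N : ℕ) (Q : ι) :
    AEMeasurable (T.approx b N Q) (μ.restrict (T.cell Q)) := by
  induction N generalizing Q with
  | zero =>
    exact (aemeasurable_const : AEMeasurable (fun _ : X => ⨍ y in T.cell Q, b y ∂μ) _)
  | succ N ih =>
    rw [← T.iUnion_child, aemeasurable_iUnion_iff]
    intro k
    refine (ih (T.child Q k)).congr ?_
    filter_upwards [ae_restrict_mem (T.measurableSet_cell _)] with x hx
    rw [approx, approx, T.descendant_succ N hx]

theorem abs_average_child_sub_le (T : NestedPartition μ ι κ) {b : X → ℝ} {K : ℝ} (hK : 0 ≤ K)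
    (hb : ∀ Q, IntegrableOn b (T.cell Q) μ)
    (hosc : ∀ Q, ∫ x in T.cell Q, |b x - ⨍ y in T.cell Q, b y ∂μ| ∂μ ≤ K * μ.real (T.cell Q))
    (Q : ι) (k : κ) :
    |(⨍ x in T.cell (T.child Q k), b x ∂μ) - ⨍ y in T.cell Q, b y ∂μ| ≤ T.ratio * K := by
  have hpos := T.measure_cell_pos (T.child Q k)
  have hfin : μ (T.cell Q) ≠ ∞ := fun h => by
    simpa [Measure.real, h] using T.measure_cell_pos Q
  have hsub : T.cell (T.child Q k) ⊆ T.cell Q := by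
    rw [← T.iUnion_child Q]; exact subset_iUnion (fun k => T.cell (T.child Q k)) k
  have hint : IntegrableOn (fun x => |b x - ⨍ y in T.cell Q, b y ∂μ|) (T.cell Q) μ :=
    ((hb Q).sub (integrableOn_const hfin)).abs
  have h1 := abs_average_sub_mul_le_setIntegral hpos (hb (T.child Q k)) (⨍ y in T.cell Q, b y ∂μ)
  have h2 : ∫ x in T.cell (T.child Q k), |b x - ⨍ y in T.cell Q, b y ∂μ| ∂μ ≤
      ∫ x in T.cell Q, |b x - ⨍ y in T.cell Q, b y ∂μ| ∂μ :=
    setIntegral_mono_set hint (Eventually.of_forall fun x => abs_nonneg _) hsub.eventuallyLE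
  have h3 : K * μ.real (T.cell Q) ≤ K * (T.ratio * μ.real (T.cell (T.child Q k))) :=
    mul_le_mul_of_nonneg_left (T.measure_le Q k) hK
  refine le_of_mul_le_mul_right ?_ hpos
  linarith [hosc Q]

/-- The exponential estimate for the approximations of a function of bounded mean oscillation,
proved by induction on the number of generations. -/
theorem lintegral_exp_approx_le (T : NestedPartition μ ι κ) {b : X → ℝ} {K c : ℝ} (hK : 0 < K)
    (hc : 0 ≤ c) (hcK : Real.exp (c * (4 * K + T.ratio * K)) ≤ 2)
    (hb : ∀ Q, IntegrableOn b (T.cell Q) μ)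
    (hosc : ∀ Q, ∫ x in T.cell Q, |b x - ⨍ y in T.cell Q, b y ∂μ| ∂μ ≤ K * μ.real (T.cell Q))
    (N : ℕ) (Q : ι) (s : ℝ) (hs : |(⨍ x in T.cell Q, b x ∂μ) - s| ≤ 4 * K) :
    ∫⁻ x in T.cell Q, ENNReal.ofReal (Real.exp (c * |T.approx b N Q x - s|)) ∂μ ≤
      ENNReal.ofReal (2 * μ.real (T.cell Q) + K⁻¹ * ∫ x in T.cell Q, |b x - s| ∂μ) := by
  have hfin : ∀ Q, μ (T.cell Q) ≠ ∞ := fun Q h => by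
    simpa [Measure.real, h] using T.measure_cell_pos Q
  have hnn : ∀ Q s, 0 ≤ ∫ x in T.cell Q, |b x - s| ∂μ := fun Q s =>
    integral_nonneg fun x => abs_nonneg _
  have hint : ∀ Q s, IntegrableOn (fun x => |b x - s|) (T.cell Q) μ := fun Q s =>
    ((hb Q).sub (integrableOn_const (hfin Q))).abs
  induction N generalizing Q s with
  | zero =>
    have h2 : Real.exp (c * |(⨍ x in T.cell Q, b x ∂μ) - s|) ≤ 2 := by
      refine (Real.exp_le_exp.2 (mul_le_mul_of_nonneg_left (hs.trans ?_) hc)).trans hcK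
      nlinarith [T.ratio_nonneg, mul_nonneg T.ratio_nonneg hK.le]
    simp only [approx, descendant, lintegral_const, Measure.restrict_apply_univ]
    rw [← ENNReal.ofReal_toReal (hfin Q), ← ENNReal.ofReal_mul (Real.exp_pos _).le]
    refine ENNReal.ofReal_le_ofReal ?_
    have h3 := mul_le_mul_of_nonneg_right h2 (T.measure_cell_pos Q).le
    have h4 : 0 ≤ K⁻¹ * ∫ x in T.cell Q, |b x - s| ∂μ := mul_nonneg (by positivity) (hnn Q s)
    change _ * μ.real _ ≤ _
    linarith
  | succ N ih =>
    have hchild : ∀ k, ∫⁻ x in T.cell (T.child Q k),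
        ENNReal.ofReal (Real.exp (c * |T.approx b (N + 1) Q x - s|)) ∂μ ≤
        ENNReal.ofReal (2 * μ.real (T.cell (T.child Q k)) +
          K⁻¹ * ∫ x in T.cell (T.child Q k), |b x - s| ∂μ) := by
      intro k
      set P := T.child Q k with hP
      have happ : ∀ x ∈ T.cell P, T.approx b (N + 1) Q x = T.approx b N P x := fun x hx => by
        rw [approx, approx, T.descendant_succ N hx]
      rw [setLIntegral_congr_fun (T.measurableSet_cell P)
        (g := fun x => ENNReal.ofReal (Real.exp (c * |T.approx b N P x - s|)))
        (fun x hx => by simp only [happ x hx])]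
      by_cases hPs : |(⨍ x in T.cell P, b x ∂μ) - s| ≤ 4 * K
      · exact ih P s hPs
      · set β := ⨍ x in T.cell P, b x ∂μ with hβ
        have hdist : |β - s| ≤ 4 * K + T.ratio * K := by
          have h1 := T.abs_average_child_sub_le hK.le hb hosc Q k
          have h2 := abs_sub_le β (⨍ y in T.cell Q, b y ∂μ) s
          linarith
        have hβP := ih P β (by simpa [← hβ] using by positivity)
        have hpt : ∀ x, ENNReal.ofReal (Real.exp (c * |T.approx b N P x - s|)) ≤
            ENNReal.ofReal 2 * ENNReal.ofReal (Real.exp (c * |T.approx b N P x - β|)) := by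
          intro x
          rw [← ENNReal.ofReal_mul zero_le_two]
          refine ENNReal.ofReal_le_ofReal ?_
          calc Real.exp (c * |T.approx b N P x - s|)
              ≤ Real.exp (c * (4 * K + T.ratio * K) + c * |T.approx b N P x - β|) := by
                rw [Real.exp_le_exp, ← mul_add]
                refine mul_le_mul_of_nonneg_left ?_ hc
                linarith [abs_sub_le (T.approx b N P x) β s]
            _ ≤ 2 * Real.exp (c * |T.approx b N P x - β|) := by
                rw [Real.exp_add]
                exact mul_le_mul_of_nonneg_right hcK (Real.exp_pos _).le
        calc ∫⁻ x in T.cell P, ENNReal.ofReal (Real.exp (c * |T.approx b N P x - s|)) ∂μ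
            ≤ ∫⁻ x in T.cell P, ENNReal.ofReal 2 *
                ENNReal.ofReal (Real.exp (c * |T.approx b N P x - β|)) ∂μ := lintegral_mono hpt
          _ = ENNReal.ofReal 2 *
                ∫⁻ x in T.cell P, ENNReal.ofReal (Real.exp (c * |T.approx b N P x - β|)) ∂μ :=
              lintegral_const_mul' _ _ ENNReal.ofReal_ne_top
          _ ≤ ENNReal.ofReal 2 * ENNReal.ofReal
                (2 * μ.real (T.cell P) + K⁻¹ * ∫ x in T.cell P, |b x - β| ∂μ) := by gcongr
          _ ≤ _ := by
              rw [← ENNReal.ofReal_mul zero_le_two]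
              refine ENNReal.ofReal_le_ofReal ?_
              have hpos := T.measure_cell_pos P
              have h1 : K⁻¹ * ∫ x in T.cell P, |b x - β| ∂μ ≤ μ.real (T.cell P) := by
                rw [inv_mul_le_iff₀ hK]
                exact hosc P
              have h2 : 4 * μ.real (T.cell P) ≤ K⁻¹ * ∫ x in T.cell P, |b x - s| ∂μ := by
                rw [le_inv_mul_iff₀ hK]
                have h3 := abs_average_sub_mul_le_setIntegral hpos (hb P) s
                have h4 := mul_le_mul_of_nonneg_right (not_le.1 hPs).le hpos.le
                linarith
              linarith
    rw [← T.iUnion_child Q, lintegral_iUnion (fun k => T.measurableSet_cell _)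
      (T.disjoint_child Q), tsum_fintype,
      integral_iUnion_fintype (fun k => T.measurableSet_cell _) (T.disjoint_child Q)
        (fun k => hint _ s),
      measureReal_iUnion_fintype (T.disjoint_child Q) (fun k => T.measurableSet_cell _)
        (fun k => hfin _), Finset.mul_sum, Finset.mul_sum, ← Finset.sum_add_distrib,
      ENNReal.ofReal_sum_of_nonneg]
    · exact Finset.sum_le_sum fun k _ => hchild k
    · intro k _
      have := hnn (T.child Q k) s
      have := (T.measure_cell_pos (T.child Q k)).le
      positivity

/-- **John-Nirenberg inequality** in exponential form for nested partitions. -/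
theorem lintegral_exp_abs_sub_average_le (T : NestedPartition μ ι κ) {b : X → ℝ} {K c : ℝ}
    (hK : 0 < K) (hc : 0 ≤ c) (hcK : Real.exp (c * (4 * K + T.ratio * K)) ≤ 2)
    (hb : ∀ Q, IntegrableOn b (T.cell Q) μ)
    (hosc : ∀ Q, ∫ x in T.cell Q, |b x - ⨍ y in T.cell Q, b y ∂μ| ∂μ ≤ K * μ.real (T.cell Q))
    (Q : ι) (hlim : ∀ᵐ x ∂μ, x ∈ T.cell Q →
      Tendsto (fun N => T.approx b N Q x) atTop (𝓝 (b x))) :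
    ∫⁻ x in T.cell Q,
        ENNReal.ofReal (Real.exp (c * |b x - ⨍ y in T.cell Q, b y ∂μ|)) ∂μ ≤
      ENNReal.ofReal (3 * μ.real (T.cell Q)) := by
  set s := ⨍ y in T.cell Q, b y ∂μ with hs
  have hbound : ∀ N,
      ∫⁻ x in T.cell Q, ENNReal.ofReal (Real.exp (c * |T.approx b N Q x - s|)) ∂μ ≤
        ENNReal.ofReal (3 * μ.real (T.cell Q)) := by
    intro N
    refine (T.lintegral_exp_approx_le hK hc hcK hb hosc N Q s ?_).trans
      (ENNReal.ofReal_le_ofReal ?_)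
    · rw [← hs, sub_self, abs_zero]
      positivity
    · have : K⁻¹ * ∫ x in T.cell Q, |b x - s| ∂μ ≤ μ.real (T.cell Q) := by
        rw [inv_mul_le_iff₀ hK]
        exact hosc Q
      linarith
  have hcont : Continuous fun t : ℝ => ENNReal.ofReal (Real.exp (c * |t - s|)) :=
    ENNReal.continuous_ofReal.comp (by fun_prop)
  have hmeas : ∀ N, AEMeasurable
      (fun x => ENNReal.ofReal (Real.exp (c * |T.approx b N Q x - s|)))
      (μ.restrict (T.cell Q)) := fun N =>
    hcont.measurable.comp_aemeasurable (T.aemeasurable_approx b N Q)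
  calc _ = ∫⁻ x in T.cell Q, liminf
        (fun N => ENNReal.ofReal (Real.exp (c * |T.approx b N Q x - s|))) atTop ∂μ := by
        refine lintegral_congr_ae ?_
        rw [EventuallyEq, ae_restrict_iff' (T.measurableSet_cell Q)]
        filter_upwards [hlim] with x hx hxQ
        exact (((hcont.tendsto (b x)).comp (hx hxQ)).liminf_eq).symm
    _ ≤ liminf (fun N => ∫⁻ x in T.cell Q,
          ENNReal.ofReal (Real.exp (c * |T.approx b N Q x - s|)) ∂μ) atTop :=
        lintegral_liminf_le' hmeas
    _ ≤ ENNReal.ofReal (3 * μ.real (T.cell Q)) :=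
        liminf_le_of_le (by isBoundedDefault) fun a ha => by
          obtain ⟨N, hN⟩ := ha.exists
          exact hN.trans (hbound N)

end NestedPartition

end NestedPartition

section FlagPartition

open scoped ENNReal NNReal

variable {d n m : ℕ}

/-- The half-open cube with corner `a` and side length `ℓ`. -/
def halfOpenCube (a : Fin d → ℝ) (ℓ : ℝ) : Set (Fin d → ℝ) :=
  univ.pi fun i => Ico (a i) (a i + ℓ)

/-- The corners of the `2 ^ d` dyadic subcubes of a cube. -/
def subCorner (a : Fin d → ℝ) (ℓ : ℝ) (ε : Fin d → Bool) (i : Fin d) : ℝ :=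
  a i + cond (ε i) (ℓ / 2) 0

theorem cube_eq_Icc (a : Fin d → ℝ) (ℓ : ℝ) : cube a ℓ = Icc a fun i => a i + ℓ := by
  ext x
  simp only [cube, mem_ofPred_eq, mem_Icc, Pi.le_def, forall_and]

theorem halfOpenCube_subset_cube (a : Fin d → ℝ) (ℓ : ℝ) : halfOpenCube a ℓ ⊆ cube a ℓ :=
  fun _ hx i => ⟨(hx i trivial).1, (hx i trivial).2.le⟩

theorem cube_subset_closedBall {a x : Fin d → ℝ} {ℓ r : ℝ} (hx : x ∈ cube a ℓ) (hℓ : ℓ ≤ r)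
    (hr : 0 ≤ r) : cube a ℓ ⊆ Metric.closedBall x r := by
  intro y hy
  rw [Metric.mem_closedBall, dist_pi_le_iff hr]
  intro i
  rw [Real.dist_eq, abs_le]
  constructor <;> linarith [(hx i).1, (hx i).2, (hy i).1, (hy i).2]

theorem halfOpenCube_ae_eq_cube (a : Fin d → ℝ) (ℓ : ℝ) :
    halfOpenCube a ℓ =ᵐ[volume] cube a ℓ := by
  rw [cube_eq_Icc]
  exact Measure.univ_pi_Ico_ae_eq_Icc

theorem measurableSet_halfOpenCube (a : Fin d → ℝ) (ℓ : ℝ) :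
    MeasurableSet (halfOpenCube a ℓ) :=
  MeasurableSet.univ_pi fun _ => measurableSet_Ico

theorem iUnion_halfOpenCube_subCorner (a : Fin d → ℝ) {ℓ : ℝ} (hℓ : 0 < ℓ) :
    ⋃ ε, halfOpenCube (subCorner a ℓ ε) (ℓ / 2) = halfOpenCube a ℓ := by
  have h := iUnion_univ_pi fun (i : Fin d) (e : Bool) =>
    Ico (a i + cond e (ℓ / 2) 0) (a i + cond e (ℓ / 2) 0 + ℓ / 2)
  refine h.trans (congrArg _ (funext fun i => ?_))
  ext t
  simp only [mem_iUnion, Bool.exists_bool, cond_true, cond_false, mem_Ico]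
  grind

theorem disjoint_halfOpenCube_subCorner (a : Fin d → ℝ) (ℓ : ℝ) {ε ε' : Fin d → Bool}
    (h : ε ≠ ε') : Disjoint (halfOpenCube (subCorner a ℓ ε) (ℓ / 2))
      (halfOpenCube (subCorner a ℓ ε') (ℓ / 2)) := by
  obtain ⟨i, hi⟩ := Function.ne_iff.1 h
  refine Set.disjoint_left.2 fun x hx hx' => ?_
  have h1 := hx i trivial
  have h2 := hx' i trivial
  simp only [subCorner, mem_Ico] at h1 h2
  cases hε : ε i <;> cases hε' : ε' i <;> simp [hε, hε'] at h1 h2 hi <;> linarith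

theorem volume_halfOpenCube (a : Fin d → ℝ) (ℓ : ℝ) :
    volume (halfOpenCube a ℓ) = ENNReal.ofReal ℓ ^ d := by
  rw [halfOpenCube, Real.volume_pi_Ico]
  simp

/-- The parameters of a flag rectangle. -/
structure FlagIndex (n m : ℕ) where
  /-- The corner of the first cube. -/
  corner₁ : Fin n → ℝ
  /-- The side length of the first cube. -/
  side₁ : ℝ
  /-- The corner of the second cube. -/
  corner₂ : Fin m → ℝ
  /-- The side length of the second cube. -/
  side₂ : ℝ
  side_pos : 0 < side₁
  side_le : side₁ ≤ side₂

namespace FlagIndex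

theorem side₂_pos (Q : FlagIndex n m) : 0 < Q.side₂ := Q.side_pos.trans_le Q.side_le

/-- The closed flag rectangle. -/
def rect (Q : FlagIndex n m) : Set (Spc n m) :=
  flagRect Q.corner₁ Q.side₁ Q.corner₂ Q.side₂

/-- The half-open flag rectangle. -/
def cell (Q : FlagIndex n m) : Set (Spc n m) :=
  halfOpenCube Q.corner₁ Q.side₁ ×ˢ halfOpenCube Q.corner₂ Q.side₂

/-- The children of a flag rectangle, obtained by bisecting all its sides. -/
def child (Q : FlagIndex n m) (k : (Fin n → Bool) × (Fin m → Bool)) : FlagIndex n m where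
  corner₁ := subCorner Q.corner₁ Q.side₁ k.1
  side₁ := Q.side₁ / 2
  corner₂ := subCorner Q.corner₂ Q.side₂ k.2
  side₂ := Q.side₂ / 2
  side_pos := half_pos Q.side_pos
  side_le := by linarith [Q.side_le]

theorem volume_cell (Q : FlagIndex n m) :
    volume Q.cell = ENNReal.ofReal (Q.side₁ ^ n * Q.side₂ ^ m) := by
  have h₁ := Q.side_pos.le
  have h₂ := Q.side₂_pos.le
  rw [cell, Measure.volume_eq_prod, Measure.prod_prod, volume_halfOpenCube, volume_halfOpenCube,
    ENNReal.ofReal_mul (by positivity), ENNReal.ofReal_pow h₁, ENNReal.ofReal_pow h₂]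

theorem measureReal_cell (Q : FlagIndex n m) :
    volume.real Q.cell = Q.side₁ ^ n * Q.side₂ ^ m := by
  have h₁ := Q.side_pos.le
  have h₂ := Q.side₂_pos.le
  rw [Measure.real, volume_cell, ENNReal.toReal_ofReal (by positivity)]

theorem cell_ae_eq_rect (Q : FlagIndex n m) : Q.cell =ᵐ[volume] Q.rect :=
  Measure.set_prod_ae_eq (halfOpenCube_ae_eq_cube _ _) (halfOpenCube_ae_eq_cube _ _)

theorem cell_subset_rect (Q : FlagIndex n m) : Q.cell ⊆ Q.rect :=
  prod_mono (halfOpenCube_subset_cube _ _) (halfOpenCube_subset_cube _ _)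

theorem isCompact_rect (Q : FlagIndex n m) : IsCompact Q.rect := by
  rw [rect, flagRect, cube_eq_Icc, cube_eq_Icc]
  exact isCompact_Icc.prod isCompact_Icc

theorem nonempty_interior_rect (Q : FlagIndex n m) : (interior Q.rect).Nonempty := by
  have h₁ := Q.side_pos
  have h₂ := Q.side₂_pos
  rw [rect, flagRect, cube_eq_Icc, cube_eq_Icc, interior_prod_eq, ← pi_univ_Icc, ← pi_univ_Icc,
    interior_pi_set finite_univ, interior_pi_set finite_univ]
  simp only [interior_Icc]
  refine Nonempty.prod (univ_pi_nonempty_iff.2 fun i => nonempty_Ioo.2 ?_)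
    (univ_pi_nonempty_iff.2 fun i => nonempty_Ioo.2 ?_) <;> linarith

theorem rect_subset_closedBall (Q : FlagIndex n m) {x : Spc n m} (hx : x ∈ Q.rect) :
    Q.rect ⊆ Metric.closedBall x Q.side₂ := by
  rw [← closedBall_prod_same]
  exact prod_mono (cube_subset_closedBall hx.1 Q.side_le Q.side₂_pos.le)
    (cube_subset_closedBall hx.2 le_rfl Q.side₂_pos.le)

end FlagIndex

/-- The dyadic structure on flag rectangles. -/
def flagPartition (n m : ℕ) : NestedPartition (volume : Measure (Spc n m)) (FlagIndex n m)
    ((Fin n → Bool) × (Fin m → Bool)) where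
  cell := FlagIndex.cell
  child := FlagIndex.child
  ratio := 2 ^ (n + m)
  ratio_nonneg := by positivity
  measurableSet_cell Q := (measurableSet_halfOpenCube _ _).prod (measurableSet_halfOpenCube _ _)
  measure_cell_pos Q := by
    have h₁ := Q.side_pos
    have h₂ := Q.side₂_pos
    rw [Q.measureReal_cell]
    positivity
  iUnion_child Q := by
    simp only [FlagIndex.cell, FlagIndex.child]
    rw [← iUnion_halfOpenCube_subCorner Q.corner₁ Q.side_pos,
      ← iUnion_halfOpenCube_subCorner Q.corner₂ Q.side₂_pos]
    exact iUnion_prod (fun ε => halfOpenCube (subCorner Q.corner₁ Q.side₁ ε) (Q.side₁ / 2))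
      fun ε => halfOpenCube (subCorner Q.corner₂ Q.side₂ ε) (Q.side₂ / 2)
  disjoint_child Q k k' h := by
    rw [Function.onFun, FlagIndex.cell, FlagIndex.cell, Set.disjoint_prod]
    by_cases h₁ : k.1 = k'.1
    · exact Or.inr (disjoint_halfOpenCube_subCorner _ _ fun h₂ => h (Prod.ext h₁ h₂))
    · exact Or.inl (disjoint_halfOpenCube_subCorner _ _ h₁)
  measure_le Q k := by
    rw [FlagIndex.measureReal_cell, FlagIndex.measureReal_cell]
    simp only [FlagIndex.child, div_pow, pow_add]
    apply le_of_eq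
    field_simp

theorem volume_closedBall_spc (x : Spc n m) {r : ℝ} (hr : 0 ≤ r) :
    volume (Metric.closedBall x r) = ENNReal.ofReal ((2 * r) ^ (n + m)) := by
  rw [← closedBall_prod_same, Measure.volume_eq_prod, Measure.prod_prod,
    Real.volume_pi_closedBall _ hr, Real.volume_pi_closedBall _ hr, Fintype.card_fin,
    Fintype.card_fin, ← ENNReal.ofReal_mul (by positivity), ← pow_add]

theorem side_descendant (N : ℕ) {Q : FlagIndex n m} {x : Spc n m} (hx : x ∈ Q.cell) :
    ((flagPartition n m).descendant N Q x).side₁ = Q.side₁ / 2 ^ N ∧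
      ((flagPartition n m).descendant N Q x).side₂ = Q.side₂ / 2 ^ N := by
  induction N generalizing Q with
  | zero => simp [NestedPartition.descendant]
  | succ N ih =>
    obtain ⟨k, hk⟩ := (flagPartition n m).exists_mem_child hx
    rw [(flagPartition n m).descendant_succ N hk]
    obtain ⟨h₁, h₂⟩ := ih hk
    rw [h₁, h₂]
    simp only [flagPartition, FlagIndex.child, pow_succ']
    constructor <;> field_simp

/-- Lebesgue differentiation along the dyadic descendants of a flag rectangle. -/
theorem ae_tendsto_approx_flagPartition {b : Spc n m → ℝ} (hb : LocallyIntegrable b volume)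
    (Q : FlagIndex n m) : ∀ᵐ x, x ∈ Q.cell →
      Tendsto (fun N => (flagPartition n m).approx b N Q x) atTop (𝓝 (b x)) := by
  have h₁ := Q.side_pos
  have h₂ := Q.side₂_pos
  set C : ℝ≥0 := Real.toNNReal (6 ^ (n + m) * (Q.side₂ / Q.side₁) ^ n) with hC
  have hC' : (C : ℝ≥0∞) = ENNReal.ofReal (6 ^ (n + m) * (Q.side₂ / Q.side₁) ^ n) := rfl
  have hratio : 1 ≤ Q.side₂ / Q.side₁ := (one_le_div h₁).2 Q.side_le
  have hdoubling : ∀ x : Spc n m, ∃ᶠ r in 𝓝[>] (0 : ℝ),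
      volume (Metric.closedBall x (3 * r)) ≤ C * volume (Metric.closedBall x r) := by
    intro x
    refine Eventually.frequently ?_
    filter_upwards [self_mem_nhdsWithin] with r hr
    have hr' : 0 < r := hr
    rw [volume_closedBall_spc x hr'.le, volume_closedBall_spc x (by positivity), hC',
      ← ENNReal.ofReal_mul (by positivity)]
    refine ENNReal.ofReal_le_ofReal ?_
    have h3 : (2 * (3 * r)) ^ (n + m) = 3 ^ (n + m) * (2 * r) ^ (n + m) := by
      rw [← mul_pow]; ring
    rw [h3]
    refine mul_le_mul_of_nonneg_right ?_ (by positivity)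
    calc (3 : ℝ) ^ (n + m) ≤ 6 ^ (n + m) := by gcongr; norm_num
      _ ≤ 6 ^ (n + m) * (Q.side₂ / Q.side₁) ^ n :=
        le_mul_of_one_le_right (by positivity) (one_le_pow₀ hratio)
  let v := Vitali.vitaliFamily (volume : Measure (Spc n m)) C hdoubling
  filter_upwards [v.ae_tendsto_average hb] with x hx hxQ
  have hmem : ∀ N, x ∈ ((flagPartition n m).descendant N Q x).cell := fun N =>
    (flagPartition n m).mem_cell_descendant N hxQ
  have hball : ∀ N, ((flagPartition n m).descendant N Q x).rect ⊆
      Metric.closedBall x (Q.side₂ / 2 ^ N) := fun N => by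
    rw [← (side_descendant N hxQ).2]
    exact FlagIndex.rect_subset_closedBall _ (FlagIndex.cell_subset_rect _ (hmem N))
  have hlim : Tendsto (fun N => ((flagPartition n m).descendant N Q x).rect) atTop
      (v.filterAt x) := by
    refine v.tendsto_filterAt_iff.2 ⟨Eventually.of_forall fun N => ?_, fun δ hδ => ?_⟩
    · refine ⟨(FlagIndex.isCompact_rect _).isClosed, FlagIndex.nonempty_interior_rect _,
        Q.side₂ / 2 ^ N, hball N, ?_⟩
      rw [volume_closedBall_spc x (by positivity), ← measure_congr (FlagIndex.cell_ae_eq_rect _),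
        FlagIndex.volume_cell, (side_descendant N hxQ).1, (side_descendant N hxQ).2, hC',
        ← ENNReal.ofReal_mul (by positivity)]
      refine ENNReal.ofReal_le_ofReal (le_of_eq ?_)
      rw [← mul_assoc 2 3]
      norm_num only
      simp only [mul_pow, div_pow, pow_add]
      field_simp
    · have h0 : Tendsto (fun N : ℕ => Q.side₂ / 2 ^ N) atTop (𝓝 0) :=
        tendsto_const_nhds.div_atTop (tendsto_pow_atTop_atTop_of_one_lt one_lt_two)
      filter_upwards [h0.eventually_le_const hδ] with N hN
      exact (hball N).trans (Metric.closedBall_subset_closedBall hN)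
  refine (hx.comp hlim).congr fun N => ?_
  exact (setAverage_congr (FlagIndex.cell_ae_eq_rect _)).symm

end FlagPartition

section ExponentialAverages

variable {n m : ℕ}

theorem avgOn_rect_eq (Q : FlagIndex n m) (f : Spc n m → ℝ) :
    avgOn Q.rect f = ⨍ x in Q.cell, f x := by
  rw [setAverage_congr (FlagIndex.cell_ae_eq_rect Q), setAverage_eq]
  rfl

/-- Averages of small exponentials of a function of bounded mean oscillation over flag
rectangles. -/
theorem exists_avgOn_exp_mul_le {b : Spc n m → ℝ} (hbm : Measurable b)
    (hb : LocallyIntegrable b volume) (hbmo : BddAbove (bmoFSet n m b)) :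
    ∃ c : ℝ, 0 < c ∧ ∀ (Q : FlagIndex n m) (t : ℝ), |t| ≤ c →
      avgOn Q.rect (fun x => Real.exp (t * b x)) ≤ 3 * Real.exp (t * avgOn Q.rect b) := by
  obtain ⟨M, hM⟩ := hbmo
  set T := flagPartition n m
  set K := max M 1
  have hK : 0 < K := lt_max_of_lt_right one_pos
  have hden : 0 < 4 * K + T.ratio * K := by
    have := mul_nonneg T.ratio_nonneg hK.le
    linarith
  set c := Real.log 2 / (4 * K + T.ratio * K) with hc
  have hc0 : 0 < c := div_pos (Real.log_pos one_lt_two) hden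
  have hcK : Real.exp (c * (4 * K + T.ratio * K)) ≤ 2 := by
    rw [hc, div_mul_cancel₀ _ hden.ne', Real.exp_log two_pos]
  have hpos : ∀ Q : FlagIndex n m, 0 < volume.real Q.cell := T.measure_cell_pos
  have hint : ∀ Q : FlagIndex n m, IntegrableOn b Q.cell volume := fun Q =>
    (hb.integrableOn_isCompact Q.isCompact_rect).mono_set Q.cell_subset_rect
  have hosc : ∀ Q : FlagIndex n m,
      ∫ x in Q.cell, |b x - ⨍ y in Q.cell, b y| ≤ K * volume.real Q.cell := by
    intro Q
    have h1 : oscOn Q.rect b ≤ M :=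
      hM ⟨Q.corner₁, Q.side₁, Q.corner₂, Q.side₂, Q.side_pos, Q.side_le, rfl⟩
    rw [oscOn, avgOn_rect_eq, avgOn_rect_eq, setAverage_eq, smul_eq_mul,
      inv_mul_le_iff₀ (hpos Q), mul_comm] at h1
    exact h1.trans (mul_le_mul_of_nonneg_right (le_max_left M 1) measureReal_nonneg)
  refine ⟨c, hc0, fun Q t ht => ?_⟩
  have hJN := T.lintegral_exp_abs_sub_average_le hK hc0.le hcK hint hosc Q
    (ae_tendsto_approx_flagPartition hb Q)
  rw [avgOn_rect_eq, avgOn_rect_eq, setAverage_eq, smul_eq_mul, inv_mul_le_iff₀ (hpos Q)]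
  set s := ⨍ y in Q.cell, b y
  rw [integral_eq_lintegral_of_nonneg_ae (Eventually.of_forall fun x => (Real.exp_pos _).le)
    (by fun_prop)]
  refine ENNReal.toReal_le_of_le_ofReal (by positivity) ?_
  calc ∫⁻ x in Q.cell, ENNReal.ofReal (Real.exp (t * b x))
      ≤ ∫⁻ x in Q.cell, ENNReal.ofReal (Real.exp (t * s)) *
          ENNReal.ofReal (Real.exp (c * |b x - s|)) := by
        refine lintegral_mono fun x => ?_
        rw [← ENNReal.ofReal_mul (Real.exp_pos _).le, ← Real.exp_add]
        refine ENNReal.ofReal_le_ofReal (Real.exp_le_exp.2 ?_)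
        have h1 : t * (b x - s) ≤ c * |b x - s| :=
          (le_abs_self _).trans ((abs_mul _ _).trans_le
            (mul_le_mul_of_nonneg_right ht (abs_nonneg _)))
        linarith
    _ = ENNReal.ofReal (Real.exp (t * s)) *
          ∫⁻ x in Q.cell, ENNReal.ofReal (Real.exp (c * |b x - s|)) :=
        lintegral_const_mul' _ _ ENNReal.ofReal_ne_top
    _ ≤ ENNReal.ofReal (Real.exp (t * s)) * ENNReal.ofReal (3 * volume.real Q.cell) :=
        mul_le_mul_right hJN _
    _ = ENNReal.ofReal (volume.real Q.cell * (3 * Real.exp (t * s))) := by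
        rw [← ENNReal.ofReal_mul (Real.exp_pos _).le]
        congr 1
        ring

end ExponentialAverages

/-- `log w ∈ bmo_F` implies `w^η ∈ A_{F,p}` for all sufficiently small `η > 0`. -/
theorem statement11 (n m : ℕ) (hn : 0 < n) (hm : 0 < m) (p : ℝ) (hp : 1 < p)
    (w : Spc n m → ℝ) (hw : ∀ x, 0 < w x) (hwm : Measurable w)
    (hlogl : LocallyIntegrable (fun x => Real.log (w x)) volume)
    (hlog : BddAbove (bmoFSet n m (fun x => Real.log (w x)))) :
    ∃ η₀ : ℝ, 0 < η₀ ∧ ∀ η : ℝ, 0 < η → η ≤ η₀ →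
      BddAbove (apSet n m p (fun x => w x ^ η)) := by
  have hp1 : 0 < p - 1 := sub_pos.2 hp
  obtain ⟨c, hc, hexp⟩ := exists_avgOn_exp_mul_le hwm.log hlogl hlog
  refine ⟨min c (c * (p - 1)), lt_min hc (mul_pos hc hp1), fun η hη hηc => ?_⟩
  refine ⟨3 * 3 ^ (p - 1), ?_⟩
  rintro v ⟨a, ℓI, e, ℓJ, hI, hIJ, rfl⟩
  set θ := η / (p - 1) with hθ
  have h₁ : |η| ≤ c := by
    rw [abs_of_pos hη]
    exact hηc.trans (min_le_left _ _)
  have h₂ : |-θ| ≤ c := by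
    rw [abs_neg, abs_of_pos (div_pos hη hp1), div_le_iff₀ hp1]
    exact hηc.trans (min_le_right _ _)
  have hw₁ : (fun x => w x ^ η) = fun x => Real.exp (η * Real.log (w x)) := by
    ext x
    rw [Real.rpow_def_of_pos (hw x), mul_comm]
  have hw₂ : (fun x => (w x ^ η) ^ (1 - p / (p - 1))) =
      fun x => Real.exp (-θ * Real.log (w x)) := by
    ext x
    rw [← Real.rpow_mul (hw x).le, Real.rpow_def_of_pos (hw x), mul_comm]
    congr 2
    rw [hθ]
    field_simp
    ring
  have hQ₁ := hexp ⟨a, ℓI, e, ℓJ, hI, hIJ⟩ η h₁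
  have hQ₂ := hexp ⟨a, ℓI, e, ℓJ, hI, hIJ⟩ (-θ) h₂
  simp only [FlagIndex.rect] at hQ₁ hQ₂
  beta_reduce
  rw [hw₂, hw₁]
  set s := avgOn (flagRect a ℓI e ℓJ) fun x => Real.log (w x)
  have hnn : 0 ≤ avgOn (flagRect a ℓI e ℓJ) fun x => Real.exp (-θ * Real.log (w x)) :=
    mul_nonneg (inv_nonneg.2 ENNReal.toReal_nonneg) (integral_nonneg fun x => (Real.exp_pos _).le)
  calc _ ≤ 3 * Real.exp (η * s) * (3 * Real.exp (-θ * s)) ^ (p - 1) :=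
        mul_le_mul hQ₁ (Real.rpow_le_rpow hnn hQ₂ hp1.le) (by positivity) (by positivity)
    _ = 3 * 3 ^ (p - 1) * (Real.exp (η * s) * Real.exp (-θ * s * (p - 1))) := by
        rw [Real.mul_rpow (by norm_num) (Real.exp_pos _).le, ← Real.exp_mul]
        ring
    _ = 3 * 3 ^ (p - 1) := by
        have h : η * s + -θ * s * (p - 1) = 0 := by
          rw [hθ]
          field_simp
          ring
        rw [← Real.exp_add, h, Real.exp_zero, mul_one]
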